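/- Let p be a prime and let Num_n(ℤ_p) denote the ℤ_p-algebra of all functions ℤ_p^n → ℤ_p that are given by evaluation of a polynomial in n variables with ℚ_p-coefficients. Then for every ℤ_p-algebra homomorphism χ : Num_n(ℤ_p) → ℤ_p there is a unique point a ∈ ℤ_p^n such that χ(f) = f(a) for all f ∈ Num_n(ℤ_p); i.e., the evaluation map ℤ_p^n → Hom_{ℤ_p-alg}(Num_n(ℤ_p), ℤ_p) is a bijection. -/

import Mathlib

variable (p : ℕ) [Fact p.Prime]

/-- `Num_n(ℤ_p)`: the `ℤ_p`-algebra of functions `ℤ_p^n → ℤ_p` given by evaluation of a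
polynomial in `n` variables with `ℚ_p`-coefficients, as a subalgebra of the algebra of
all functions `ℤ_p^n → ℤ_p` with pointwise operations. -/
def padicNumRing (n : ℕ) : Subalgebra ℤ_[p] ((Fin n → ℤ_[p]) → ℤ_[p]) where
  carrier := {f | ∃ P : MvPolynomial (Fin n) ℚ_[p],
    ∀ x : Fin n → ℤ_[p], (f x : ℚ_[p]) = MvPolynomial.eval (fun i => (x i : ℚ_[p])) P}
  algebraMap_mem' := by
    intro c
    refine ⟨MvPolynomial.C (c : ℚ_[p]), fun x => by simp⟩
  add_mem' := by
    rintro f g ⟨P, hP⟩ ⟨Q, hQ⟩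
    exact ⟨P + Q, fun x => by
      simp only [Pi.add_apply, map_add, ← hP x, ← hQ x]; push_cast; ring⟩
  mul_mem' := by
    rintro f g ⟨P, hP⟩ ⟨Q, hQ⟩
    exact ⟨P * Q, fun x => by
      simp only [Pi.mul_apply, map_mul, ← hP x, ← hQ x]; push_cast; ring⟩

theorem MvPolynomial.exists_map_eq_C_mul {σ A K : Type*} [CommRing A] [IsDomain A] [Field K]
    [Algebra A K] [IsFractionRing A K] (P : MvPolynomial σ K) :
    ∃ c : A, c ≠ 0 ∧ ∃ Q : MvPolynomial σ A,
      map (algebraMap A K) Q = C (algebraMap A K c) * P := by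
  induction P using MvPolynomial.induction_on with
  | C a =>
    obtain ⟨x, y, hy, rfl⟩ := IsFractionRing.div_surjective (A := A) a
    have hy0 : algebraMap A K y ≠ 0 := IsFractionRing.to_map_ne_zero_of_mem_nonZeroDivisors hy
    refine ⟨y, nonZeroDivisors.ne_zero hy, C x, ?_⟩
    rw [map_C, ← C_mul, mul_div_cancel₀ _ hy0]
  | add P₁ P₂ h₁ h₂ =>
    obtain ⟨c₁, hc₁, Q₁, hQ₁⟩ := h₁
    obtain ⟨c₂, hc₂, Q₂, hQ₂⟩ := h₂
    refine ⟨c₁ * c₂, mul_ne_zero hc₁ hc₂, C c₂ * Q₁ + C c₁ * Q₂, ?_⟩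
    simp only [map_add, map_mul, map_C, hQ₁, hQ₂]
    ring
  | mul_X P i h =>
    obtain ⟨c, hc, Q, hQ⟩ := h
    refine ⟨c, hc, Q * X i, ?_⟩
    rw [map_mul, map_X, hQ, mul_assoc]

/-- The `i`-th coordinate function as an element of `padicNumRing p n`. -/
def padicNumRing.coord (n : ℕ) (i : Fin n) : padicNumRing p n :=
  ⟨fun x => x i, MvPolynomial.X i, fun x => by simp⟩

theorem padicNumRing.coe_aeval_coord (n : ℕ) (Q : MvPolynomial (Fin n) ℤ_[p])
    (x : Fin n → ℤ_[p]) :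
    (MvPolynomial.aeval (coord p n) Q : (Fin n → ℤ_[p]) → ℤ_[p]) x = MvPolynomial.eval x Q := by
  have h : ((Pi.evalAlgHom ℤ_[p] (fun _ : Fin n → ℤ_[p] => ℤ_[p]) x).comp
      (padicNumRing p n).val).comp (MvPolynomial.aeval (coord p n)) = MvPolynomial.aeval x := by
    ext i
    simp [coord]
  exact DFunLike.congr_fun h Q

theorem padicNumRing.exists_smul_eq_aeval_coord (n : ℕ) (f : padicNumRing p n) :
    ∃ c : ℤ_[p], c ≠ 0 ∧ ∃ Q : MvPolynomial (Fin n) ℤ_[p],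
      c • f = MvPolynomial.aeval (coord p n) Q := by
  obtain ⟨P, hP⟩ := f.2
  obtain ⟨c, hc, Q, hQ⟩ := P.exists_map_eq_C_mul (A := ℤ_[p])
  refine ⟨c, hc, Q, Subtype.ext (funext fun x => ?_)⟩
  rw [coe_aeval_coord]
  have h := congrArg (MvPolynomial.eval (algebraMap ℤ_[p] ℚ_[p] ∘ x)) hQ
  rw [map_mul, MvPolynomial.eval_C, ← MvPolynomial.map_eval] at h
  apply IsFractionRing.injective ℤ_[p] ℚ_[p]
  rw [h]
  change algebraMap ℤ_[p] ℚ_[p] (c * f.1 x) = _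
  rw [map_mul]
  exact congrArg _ (hP x)

/-- Every `ℤ_p`-algebra homomorphism `χ : Num_n(ℤ_p) → ℤ_p` is evaluation at a unique
point `a ∈ ℤ_p^n`; i.e., the evaluation map `ℤ_p^n → Hom_{ℤ_p-alg}(Num_n(ℤ_p), ℤ_p)`
is a bijection. -/
theorem padicNumRing_algHom_eq_eval (n : ℕ) (χ : padicNumRing p n →ₐ[ℤ_[p]] ℤ_[p]) :
    ∃! a : Fin n → ℤ_[p], ∀ f : padicNumRing p n,
      χ f = (f : (Fin n → ℤ_[p]) → ℤ_[p]) a := by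
  refine ⟨fun i => χ (padicNumRing.coord p n i), fun f => ?_, fun b hb => ?_⟩
  · obtain ⟨c, hc, Q, hQ⟩ := padicNumRing.exists_smul_eq_aeval_coord p n f
    apply mul_left_cancel₀ hc
    have h₁ : c * χ f = MvPolynomial.eval (fun i => χ (padicNumRing.coord p n i)) Q := by
      rw [← smul_eq_mul, ← map_smul, hQ, ← AlgHom.comp_apply, MvPolynomial.comp_aeval]
      rfl
    rw [h₁, ← padicNumRing.coe_aeval_coord, ← hQ]
    rfl
  · funext i
    exact (hb (padicNumRing.coord p n i)).symm
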